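/- Let G be a graph with two edge-disjoint loopless factors M and M0 satisfying Δ(M) ≤ m and |E(M0)| ≤ m, and for each vertex v let r(v) be a nonnegative integer such that Σ_{v∈V(G)} r(v) = m − |E(M0)|. If G is 2m-edge-connected, then G has an m-tree-connected factor F including M and excluding M0, and any given pre-orientation of M0 can be extended to an orientation of G such that for each vertex v, d⁺_G(v) ≤ ⌈d_G(v)/2⌉ and d⁻_F(v) = m − r(v) − d⁻_{M0}(v). Furthermore, for an arbitrary given vertex z, one can additionally require d⁺_G(z) ≤ ⌊d_G(z)/2⌋. -/

import Mathlib

open Finset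

variable {V E : Type*}

/-- Degree of vertex `v` in the multigraph whose edge set is `S`
(the ambient multigraph is given by the endpoint map `ends`); a loop counts twice. -/
def mdeg [DecidableEq V] (ends : E → V × V) (S : Finset E) (v : V) : ℕ :=
  ∑ e ∈ S, ((if (ends e).1 = v then 1 else 0) + (if (ends e).2 = v then 1 else 0))

/-- The multigraph with edge set `S` is connected: all vertices are mutually reachable. -/
def MConnected (ends : E → V × V) (S : Finset E) : Prop :=
  ∀ u v : V, Relation.ReflTransGen
    (fun a b => ∃ e ∈ S, ends e = (a, b) ∨ ends e = (b, a)) u v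

/-- `T` is (the edge set of) a spanning tree: connected and with `|V| - 1` edges. -/
def IsSpanningTree [Fintype V] (ends : E → V × V) (T : Finset E) : Prop :=
  MConnected ends T ∧ T.card + 1 = Fintype.card V

/-- `S` is `m`-tree-connected: it contains `m` pairwise edge-disjoint spanning trees. -/
def TreeConnected [Fintype V] (ends : E → V × V) (m : ℕ) (S : Finset E) : Prop :=
  ∃ T : Fin m → Finset E, (∀ i, T i ⊆ S ∧ IsSpanningTree ends (T i)) ∧
    ∀ i j, i ≠ j → Disjoint (T i) (T j)

/-- The edges of `S` crossing the cut `(A, Aᶜ)`. -/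
def cutEdges [DecidableEq V] (ends : E → V × V) (S : Finset E) (A : Finset V) : Finset E :=
  S.filter fun e => ¬(((ends e).1 ∈ A) ↔ ((ends e).2 ∈ A))

/-- `S` is `m`-edge-connected: every edge cut has at least `m` edges. -/
def EdgeConnected [Fintype V] [DecidableEq V] (ends : E → V × V) (m : ℕ) (S : Finset E) : Prop :=
  ∀ A : Finset V, A.Nonempty → A ≠ Finset.univ → m ≤ (cutEdges ends S A).card

/-- Tail of the edge `e` under the orientation `σ`. -/
def otail (ends : E → V × V) (σ : E → Bool) (e : E) : V :=
  if σ e then (ends e).1 else (ends e).2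

/-- Head of the edge `e` under the orientation `σ`. -/
def ohead (ends : E → V × V) (σ : E → Bool) (e : E) : V :=
  if σ e then (ends e).2 else (ends e).1

/-- Out-degree of `v` in the edge set `S` under the orientation `σ`. -/
def outDeg [DecidableEq V] (ends : E → V × V) (σ : E → Bool) (S : Finset E) (v : V) : ℕ :=
  (S.filter fun e => otail ends σ e = v).card

/-- In-degree of `v` in the edge set `S` under the orientation `σ`. -/
def inDeg [DecidableEq V] (ends : E → V × V) (σ : E → Bool) (S : Finset E) (v : V) : ℕ :=
  (S.filter fun e => ohead ends σ e = v).card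

/-- Out-degree in a directed graph, where `ends` itself records the orientation
(first component = tail, second component = head). -/
def outDegD [DecidableEq V] (ends : E → V × V) (S : Finset E) (v : V) : ℕ :=
  (S.filter fun e => (ends e).1 = v).card

/-- In-degree in a directed graph. -/
def inDegD [DecidableEq V] (ends : E → V × V) (S : Finset E) (v : V) : ℕ :=
  (S.filter fun e => (ends e).2 = v).card

/-- `S` is `(m, l)`-partition-connected: it decomposes into an `m`-tree-connected factor
and a factor admitting an orientation in which every vertex `v` has out-degree at least `l v`. -/
def PartitionConnected [Fintype V] [DecidableEq V] [DecidableEq E]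
    (ends : E → V × V) (m : ℕ) (l : V → ℤ) (S : Finset E) : Prop :=
  ∃ S₁ ⊆ S, TreeConnected ends m S₁ ∧
    ∃ σ : E → Bool, ∀ v, l v ≤ (outDeg ends σ (S \ S₁) v : ℤ)

/-- Number of edges of `S` with both ends in `A`. -/
def eIn [DecidableEq V] (ends : E → V × V) (S : Finset E) (A : Finset V) : ℕ :=
  (S.filter fun e => (ends e).1 ∈ A ∧ (ends e).2 ∈ A).card

/-- Number of edges of `S` with one end in `A` and the other end in `B`. -/
def eBetween [DecidableEq V] (ends : E → V × V) (S : Finset E) (A B : Finset V) : ℕ :=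
  (S.filter fun e =>
    ((ends e).1 ∈ A ∧ (ends e).2 ∈ B) ∨ ((ends e).1 ∈ B ∧ (ends e).2 ∈ A)).card

/-- Every edge of `S` crosses the bipartition `(X, Xᶜ)`. -/
def BipartiteWrt [DecidableEq V] (ends : E → V × V) (S : Finset E) (X : Finset V) : Prop :=
  ∀ e ∈ S, ¬(((ends e).1 ∈ X) ↔ ((ends e).2 ∈ X))

/-- The multigraph with edge set `S` is bipartite. -/
def IsBipartiteG [DecidableEq V] (ends : E → V × V) (S : Finset E) : Prop :=
  ∃ X : Finset V, BipartiteWrt ends S X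

/-- Bipartite index: the smallest number of edges whose deletion from `S`
leaves a bipartite factor. -/
noncomputable def biIndex [DecidableEq V] [DecidableEq E]
    (ends : E → V × V) (S : Finset E) : ℕ :=
  sInf {n | ∃ H ⊆ S, IsBipartiteG ends H ∧ n = (S \ H).card}

/-- `f : V → ZMod k` is compatible with the multigraph `S` with respect to the
bipartition `(X, Xᶜ)`. -/
def CompatibleWrt [Fintype V] [DecidableEq V] (ends : E → V × V) (S : Finset E)
    {k : ℕ} (f : V → ZMod k) (X : Finset V) : Prop :=
  (∃ x : ℕ, x ≤ eIn ends S X ∧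
    (∑ v ∈ X, f v) - 2 * (x : ZMod k) = ∑ v ∈ Xᶜ, f v) ∨
  (∃ y : ℕ, y ≤ eIn ends S Xᶜ ∧
    (∑ v ∈ X, f v) = (∑ v ∈ Xᶜ, f v) - 2 * (y : ZMod k))

/-- `f : V → ZMod k` is compatible with `S`: compatible with respect to every bipartition. -/
def Compatible [Fintype V] [DecidableEq V] (ends : E → V × V) (S : Finset E)
    {k : ℕ} (f : V → ZMod k) : Prop :=
  ∀ X : Finset V, CompatibleWrt ends S f X

lemma rado_aux {E I : Type*} [DecidableEq E] [DecidableEq I] [Fintype I] [Inhabited I]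
    (f : I → Finset E → ℕ) (mono : ∀ i S T, S ⊆ T → f i S ≤ f i T)
    (sub : ∀ i S T, f i (S ∪ T) + f i (S ∩ T) ≤ f i S + f i T)
    (f0 : ∀ i, f i ∅ = 0) (X : Finset E) :
    ∀ (k : ℕ) (A : E → Finset I), ∑ e ∈ X, (A e).card = k →
      (∀ J ⊆ X, J.card ≤ ∑ i, f i (J.filter (fun e => i ∈ A e))) →
      ∃ φ : E → I, (∀ e ∈ X, φ e ∈ A e) ∧
        ∀ i J, J ⊆ X → (∀ e ∈ J, φ e = i) → J.card ≤ f i J := by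
  intro k
  induction k using Nat.strong_induction_on with
  | _ k ih =>
  intro A hk hA
  by_cases hs : ∀ e ∈ X, (A e).card ≤ 1
  · have hne : ∀ e ∈ X, ∃ i, A e = {i} := by
      intro e he
      rw [← Finset.card_eq_one]
      refine le_antisymm (hs e he) ?_
      rw [Nat.one_le_iff_ne_zero]
      intro h0
      rw [Finset.card_eq_zero] at h0
      have := hA {e} (by simpa using he)
      have h2 : ∀ i, ({e} : Finset E).filter (fun e => i ∈ A e) = ∅ := by
        intro i
        ext x
        simp only [Finset.mem_filter, Finset.mem_singleton, Finset.notMem_empty, iff_false]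
        rintro ⟨rfl, h⟩
        simp [h0] at h
      simp [h2, f0] at this
    choose! φ hφ using hne
    refine ⟨φ, fun e he => by simp [hφ e he], ?_⟩
    intro i J hJ hi
    refine (hA J hJ).trans ?_
    rw [Finset.sum_eq_single i]
    · exact mono _ _ _ (Finset.filter_subset _ _)
    · intro j _ hj
      have : J.filter (fun e => j ∈ A e) = ∅ := by
        ext x
        simp only [Finset.mem_filter, Finset.notMem_empty, iff_false]
        rintro ⟨hx, h⟩
        rw [hφ x (hJ hx), hi x hx] at h
        exact hj (by simpa using h)
      rw [this, f0]
    · simp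
  · push Not at hs
    obtain ⟨e, he, hc⟩ := hs
    obtain ⟨x, hx, y, hy, hxy⟩ := Finset.one_lt_card.mp hc
    have key : ∀ w ∈ A e, (∃ φ : E → I, (∀ e ∈ X, φ e ∈ A e) ∧
        ∀ i J, J ⊆ X → (∀ e ∈ J, φ e = i) → J.card ≤ f i J) ∨
        ∃ J ⊆ X, e ∈ J ∧
          ∑ i, f i (J.filter (fun a => i ∈ A a ∧ ¬ (a = e ∧ i = w))) < J.card := by
      intro w hw
      by_cases hB : ∀ J ⊆ X, J.card ≤
          ∑ i, f i (J.filter (fun a => i ∈ Function.update A e ((A e).erase w) a))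
      · left
        have hlt : ∑ a ∈ X, (Function.update A e ((A e).erase w) a).card < k := by
          rw [← hk]
          apply Finset.sum_lt_sum
          · intro a _
            by_cases h : a = e
            · subst h; simp only [Function.update_self]
              exact Finset.card_le_card (Finset.erase_subset _ _)
            · simp [h]
          · refine ⟨e, he, ?_⟩
            simp only [Function.update_self]
            exact Finset.card_erase_lt_of_mem hw
        obtain ⟨φ, h1, h2⟩ := ih _ hlt _ rfl hB
        refine ⟨φ, ?_, h2⟩
        intro a ha
        have := h1 a ha
        by_cases h : a = e
        · subst h
          simp only [Function.update_self] at this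
          exact Finset.mem_of_mem_erase this
        · simpa [h] using this
      · right
        push Not at hB
        obtain ⟨J, hJ, hlt⟩ := hB
        have hfe : ∀ i, J.filter (fun a => i ∈ Function.update A e ((A e).erase w) a) =
            J.filter (fun a => i ∈ A a ∧ ¬ (a = e ∧ i = w)) := by
          intro i
          apply Finset.filter_congr
          intro a _
          by_cases h : a = e
          · subst h; simp [Finset.mem_erase, and_comm]
          · simp [h]
        simp only [hfe] at hlt
        refine ⟨J, hJ, ?_, hlt⟩
        by_contra hej
        have := hA J hJ
        have hh : ∀ i, J.filter (fun a => i ∈ A a ∧ ¬ (a = e ∧ i = w)) =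
            J.filter (fun a => i ∈ A a) := by
          intro i
          apply Finset.filter_congr
          intro a ha
          have : a ≠ e := by rintro rfl; exact hej ha
          simp [this]
        simp only [hh] at hlt
        omega
    rcases key x hx with h | ⟨J, hJ, heJ, hJl⟩
    · exact h
    rcases key y hy with h | ⟨K, hK, heK, hKl⟩
    · exact h
    exfalso
    have h1 := hA (J ∪ K) (Finset.union_subset hJ hK)
    have h2 := hA ((J ∩ K).erase e)
      ((Finset.erase_subset _ _).trans (Finset.inter_subset_left.trans hJ))
    have h3 : (J ∪ K).card + (J ∩ K).card = J.card + K.card := Finset.card_union_add_card_inter _ _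
    have h4 : ((J ∩ K).erase e).card + 1 = (J ∩ K).card :=
      Finset.card_erase_add_one (by simp [heJ, heK])
    have h5 : ∑ i, f i ((J ∪ K).filter (fun e => i ∈ A e)) +
        ∑ i, f i (((J ∩ K).erase e).filter (fun e => i ∈ A e)) ≤
        ∑ i, f i (J.filter (fun a => i ∈ A a ∧ ¬ (a = e ∧ i = x))) +
        ∑ i, f i (K.filter (fun a => i ∈ A a ∧ ¬ (a = e ∧ i = y))) := by
      rw [← Finset.sum_add_distrib, ← Finset.sum_add_distrib]
      apply Finset.sum_le_sum
      intro i _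
      refine le_trans (add_le_add (mono i _ _ ?_) (mono i _ _ ?_)) (sub i _ _)
      · intro a
        simp only [Finset.mem_filter, Finset.mem_union]
        rintro ⟨h, hi⟩
        by_cases hae : a = e
        · subst hae
          by_cases hix : i = x
          · right; exact ⟨heK, hi, by rintro ⟨_, rfl⟩; exact hxy hix.symm⟩
          · left; exact ⟨heJ, hi, by tauto⟩
        · tauto
      · intro a
        simp only [Finset.mem_filter, Finset.mem_inter, Finset.mem_erase]
        tauto
    omega

lemma rado {E I : Type*} [DecidableEq E] [DecidableEq I] [Fintype I] [Inhabited I]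
    (f : I → Finset E → ℕ) (mono : ∀ i S T, S ⊆ T → f i S ≤ f i T)
    (sub : ∀ i S T, f i (S ∪ T) + f i (S ∩ T) ≤ f i S + f i T)
    (f0 : ∀ i, f i ∅ = 0) (X : Finset E) (A : E → Finset I)
    (hA : ∀ J ⊆ X, J.card ≤ ∑ i, f i (J.filter (fun e => i ∈ A e))) :
      ∃ φ : E → I, (∀ e ∈ X, φ e ∈ A e) ∧
        ∀ i J, J ⊆ X → (∀ e ∈ J, φ e = i) → J.card ≤ f i J :=
  rado_aux f mono sub f0 X _ A rfl hA

/-- Functions constant along the edges of `S`. -/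
def constSub (ends : E → V × V) (S : Finset E) : Submodule ℚ (V → ℚ) where
  carrier := {g | ∀ e ∈ S, g (ends e).1 = g (ends e).2}
  add_mem' := by
    intro a b ha hb e he
    simp [ha e he, hb e he]
  zero_mem' := by intro e _; rfl
  smul_mem' := by
    intro c a ha e he
    simp [ha e he]

/-- Graphic rank. -/
noncomputable def grk [Fintype V] (ends : E → V × V) (S : Finset E) : ℕ :=
  Fintype.card V - Module.finrank ℚ (constSub ends S)

lemma grk_add [Fintype V] (ends : E → V × V) (S : Finset E) :
    grk ends S + Module.finrank ℚ (constSub ends S) = Fintype.card V := by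
  have := Submodule.finrank_le (constSub ends S)
  rw [Module.finrank_fintype_fun_eq_card] at this
  unfold grk
  omega

lemma constSub_anti (ends : E → V × V) {S T : Finset E} (h : S ⊆ T) :
    constSub ends T ≤ constSub ends S := fun _ hg e he => hg e (h he)

lemma grk_mono [Fintype V] (ends : E → V × V) (S T : Finset E) (h : S ⊆ T) :
    grk ends S ≤ grk ends T := by
  have h1 := grk_add ends S
  have h2 := grk_add ends T
  have := Submodule.finrank_mono (constSub_anti ends h)
  omega

lemma grk_sub [Fintype V] [DecidableEq E] (ends : E → V × V) (S T : Finset E) :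
    grk ends (S ∪ T) + grk ends (S ∩ T) ≤ grk ends S + grk ends T := by
  have h1 := grk_add ends S
  have h2 := grk_add ends T
  have h3 := grk_add ends (S ∪ T)
  have h4 := grk_add ends (S ∩ T)
  have h5 := Submodule.finrank_sup_add_finrank_inf_eq (constSub ends S) (constSub ends T)
  have h6 : constSub ends S ⊔ constSub ends T ≤ constSub ends (S ∩ T) :=
    sup_le (constSub_anti ends Finset.inter_subset_left)
      (constSub_anti ends Finset.inter_subset_right)
  have h7 : constSub ends S ⊓ constSub ends T ≤ constSub ends (S ∪ T) := by
    rintro g ⟨ha, hb⟩ e he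
    rcases Finset.mem_union.mp he with h | h
    · exact ha e h
    · exact hb e h
  have h8 := Submodule.finrank_mono h6
  have h9 := Submodule.finrank_mono h7
  omega

lemma grk_empty [Fintype V] (ends : E → V × V) : grk ends (∅ : Finset E) = 0 := by
  have h : constSub ends (∅ : Finset E) = ⊤ := by
    rw [eq_top_iff]
    intro g _ e he
    simp at he
  have := grk_add ends (∅ : Finset E)
  rw [h, finrank_top, Module.finrank_fintype_fun_eq_card] at this
  omega

lemma quot_exists [Fintype V] (ends : E → V × V) (S : Finset E) :
    ∃ (k : ℕ) (q : V → Fin k), Function.Surjective q ∧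
      (∀ e ∈ S, q (ends e).1 = q (ends e).2) ∧
      (∀ u v, q u = q v → Relation.ReflTransGen
        (fun a b => ∃ e ∈ S, ends e = (a, b) ∨ ends e = (b, a)) u v) ∧
      Module.finrank ℚ (constSub ends S) = k := by
  classical
  set R : V → V → Prop := fun a b => ∃ e ∈ S, ends e = (a, b) ∨ ends e = (b, a) with hR
  have hsym : ∀ a b, R a b → R b a := by
    rintro a b ⟨e, he, h⟩
    exact ⟨e, he, h.symm⟩
  have hsymm : ∀ a b, Relation.ReflTransGen R a b → Relation.ReflTransGen R b a := by
    intro a b h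
    induction h with
    | refl => exact .refl
    | tail _ h2 ih => exact .head (hsym _ _ h2) ih
  let s : Setoid V := ⟨Relation.ReflTransGen R, fun _ => .refl, fun h => hsymm _ _ h,
    fun h1 h2 => h1.trans h2⟩
  let eqv := Fintype.equivFin (Quotient s)
  let q : V → Fin (Fintype.card (Quotient s)) := fun v => eqv (Quotient.mk s v)
  have hq : Function.Surjective q := eqv.surjective.comp Quotient.mk_surjective
  have hq2 : ∀ u v, q u = q v ↔ Relation.ReflTransGen R u v := by
    intro u v
    simp only [q, eqv.injective.eq_iff]
    exact Quotient.eq (r := s)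
  have hqe : ∀ e ∈ S, q (ends e).1 = q (ends e).2 := fun e he =>
    (hq2 _ _).2 (.single ⟨e, he, Or.inl rfl⟩)
  refine ⟨_, q, hq, hqe, fun u v h => (hq2 u v).1 h, ?_⟩
  have hrange : LinearMap.range (LinearMap.funLeft ℚ ℚ q) = constSub ends S := by
    ext g
    constructor
    · rintro ⟨h, rfl⟩ e he
      simp [LinearMap.funLeft_apply, hqe e he]
    · intro hg
      have hg' : ∀ u v, Relation.ReflTransGen R u v → g u = g v := by
        intro u v h
        induction h with
        | refl => rfl
        | tail _ h2 ih =>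
          rw [ih]
          obtain ⟨e, he, h | h⟩ := h2
          · have := hg e he; rw [h] at this; exact this
          · have := hg e he; rw [h] at this; exact this.symm
      refine ⟨fun c => g (Function.surjInv hq c), ?_⟩
      ext v
      simp only [LinearMap.funLeft_apply]
      exact hg' _ _ ((hq2 _ _).1 (Function.surjInv_eq hq _))
  rw [← hrange, LinearMap.finrank_range_of_inj (LinearMap.funLeft_injective_of_surjective ℚ ℚ q hq)]
  simp

lemma mconn_of_grk [Fintype V] (ends : E → V × V) (S : Finset E)
    (h : Fintype.card V ≤ grk ends S + 1) : MConnected ends S := by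
  obtain ⟨k, q, _, _, h3, h4⟩ := quot_exists ends S
  have := grk_add ends S
  intro u v
  apply h3
  ext
  have := (q u).2
  have := (q v).2
  omega

lemma grk_lt [Fintype V] [Nonempty V] (ends : E → V × V) (S : Finset E) :
    grk ends S + 1 ≤ Fintype.card V := by
  obtain ⟨k, q, _, _, h3, h4⟩ := quot_exists ends S
  have := grk_add ends S
  have := (q (Classical.arbitrary V)).2
  omega

lemma grk_touch [Fintype V] [DecidableEq V] (ends : E → V × V) (S : Finset E) (hS : S.Nonempty)
    (T : Finset V) (hT : ∀ e ∈ S, (ends e).1 ∈ T ∧ (ends e).2 ∈ T) :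
    grk ends S + 1 ≤ T.card := by
  obtain ⟨e0, he0⟩ := hS
  let Φ : (Option {v // v ∉ T} → ℚ) →ₗ[ℚ] (V → ℚ) :=
    LinearMap.funLeft ℚ ℚ (fun v => if h : v ∈ T then none else some ⟨v, h⟩)
  have hinj : Function.Injective Φ := by
    apply LinearMap.funLeft_injective_of_surjective
    intro o
    cases o with
    | none => exact ⟨(ends e0).1, by simp [(hT e0 he0).1]⟩
    | some w => exact ⟨w.1, by simp [w.2]⟩
  have hle : LinearMap.range Φ ≤ constSub ends S := by
    rintro _ ⟨g, rfl⟩ e he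
    simp [Φ, LinearMap.funLeft_apply, hT e he]
  have h1 := Submodule.finrank_mono hle
  rw [LinearMap.finrank_range_of_inj hinj] at h1
  simp only [Module.finrank_fintype_fun_eq_card, Fintype.card_option] at h1
  have h2 : Fintype.card {v // v ∉ T} = Fintype.card V - T.card := by
    rw [Fintype.card_subtype_compl]; simp
  have := grk_add ends S
  have := Finset.card_le_univ T
  omega

lemma sum_mdeg [DecidableEq V] (ends : E → V × V) (S : Finset E) (W : Finset V) :
    ∑ v ∈ W, mdeg ends S v =
      ∑ e ∈ S, ((if (ends e).1 ∈ W then 1 else 0) + (if (ends e).2 ∈ W then 1 else 0)) := by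
  unfold mdeg
  rw [Finset.sum_comm]
  apply Finset.sum_congr rfl
  intro e _
  rw [Finset.sum_add_distrib]
  simp

lemma sum_mdeg_le [DecidableEq V] (ends : E → V × V) (S : Finset E) (m : ℕ)
    (hΔ : ∀ v, mdeg ends S v ≤ m) (W : Finset V) : ∑ v ∈ W, mdeg ends S v ≤ m * W.card := by
  calc _ ≤ ∑ v ∈ W, m := Finset.sum_le_sum fun v _ => hΔ v
    _ = m * W.card := by simp [mul_comm]

lemma inside_bound [DecidableEq V] (ends : E → V × V) (M : Finset E) (m : ℕ)
    (hMloop : ∀ e ∈ M, (ends e).1 ≠ (ends e).2) (hΔ : ∀ v, mdeg ends M v ≤ m)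
    (P : Finset V) (hP : P.Nonempty) :
    (M.filter (fun e => (ends e).1 ∈ P ∧ (ends e).2 ∈ P)).card + m ≤ m * P.card := by
  by_cases h1 : P.card = 1
  · obtain ⟨a, rfl⟩ := Finset.card_eq_one.mp h1
    have : M.filter (fun e => (ends e).1 ∈ ({a} : Finset V) ∧ (ends e).2 ∈ ({a} : Finset V)) = ∅ := by
      ext e
      simp only [Finset.mem_filter, Finset.mem_singleton, Finset.notMem_empty, iff_false]
      rintro ⟨he, h, h'⟩
      exact hMloop e he (h.trans h'.symm)
    rw [this]; simp
  · have h2 : 2 ≤ P.card := by have := hP.card_pos; omega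
    have h3 : 2 * (M.filter (fun e => (ends e).1 ∈ P ∧ (ends e).2 ∈ P)).card ≤
        ∑ v ∈ P, mdeg ends M v := by
      rw [sum_mdeg, Finset.card_filter, Finset.mul_sum]
      apply Finset.sum_le_sum
      intro e _
      split_ifs <;> first | omega | tauto
    have h4 := sum_mdeg_le ends M m hΔ P
    nlinarith

lemma touch_bound [DecidableEq V] (ends : E → V × V) (M : Finset E) (m : ℕ)
    (hΔ : ∀ v, mdeg ends M v ≤ m) (W : Finset V) :
    (M.filter (fun e => (ends e).1 ∈ W ∨ (ends e).2 ∈ W)).card ≤ m * W.card := by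
  refine le_trans ?_ (sum_mdeg_le ends M m hΔ W)
  rw [sum_mdeg, Finset.card_filter]
  apply Finset.sum_le_sum
  intro e _
  split_ifs <;> first | omega | tauto

lemma mu_bound [Fintype V] [DecidableEq V] (ends : E → V × V) (M : Finset E) (m : ℕ)
    (hMloop : ∀ e ∈ M, (ends e).1 ≠ (ends e).2) (hΔ : ∀ v, mdeg ends M v ≤ m)
    {k : ℕ} (q : V → Fin k) (hq : Function.Surjective q) (W : Finset V) :
    (M.filter (fun e => q (ends e).1 = q (ends e).2 ∧ ((ends e).1 ∈ W ∨ (ends e).2 ∈ W))).card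
      + m * ∑ c : Fin k, (if (univ.filter (fun v => q v = c ∧ v ∉ W)) = ∅ then 1 else 0)
      ≤ m * W.card := by
  have e1 : (M.filter (fun e => q (ends e).1 = q (ends e).2 ∧
      ((ends e).1 ∈ W ∨ (ends e).2 ∈ W))).card =
      ∑ c : Fin k, ((M.filter (fun e => q (ends e).1 = q (ends e).2 ∧
      ((ends e).1 ∈ W ∨ (ends e).2 ∈ W))).filter (fun e => q (ends e).1 = c)).card :=
    Finset.card_eq_sum_card_fiberwise (fun _ _ => Finset.mem_coe.2 (Finset.mem_univ _))
  have e2 : W.card = ∑ c : Fin k, (W.filter (fun v => q v = c)).card :=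
    Finset.card_eq_sum_card_fiberwise (fun _ _ => Finset.mem_coe.2 (Finset.mem_univ _))
  rw [e1, e2, Finset.mul_sum, Finset.mul_sum, ← Finset.sum_add_distrib]
  apply Finset.sum_le_sum
  intro c _
  split_ifs with hU
  · have hP : ∀ v, q v = c → v ∈ W := by
      intro v hv
      by_contra hw
      have : v ∈ univ.filter (fun v => q v = c ∧ v ∉ W) := by simp [hv, hw]
      rw [hU] at this
      simp at this
    have hne : (W.filter (fun v => q v = c)).Nonempty := by
      obtain ⟨v, hv⟩ := hq c
      exact ⟨v, by simp [hv, hP v hv]⟩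
    have := inside_bound ends M m hMloop hΔ _ hne
    refine le_trans ?_ this
    rw [mul_one]
    apply Nat.add_le_add_right
    apply Finset.card_le_card
    intro e
    simp only [Finset.mem_filter]
    rintro ⟨⟨he, h1, _⟩, h3⟩
    have h4 := h1.symm.trans h3
    exact ⟨he, ⟨hP _ h3, h3⟩, ⟨hP _ h4, h4⟩⟩
  · refine le_trans ?_ (touch_bound ends M m hΔ _)
    rw [mul_zero, add_zero]
    apply Finset.card_le_card
    intro e
    simp only [Finset.mem_filter]
    rintro ⟨⟨he, h1, h2⟩, h3⟩
    have h4 := h1.symm.trans h3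
    exact ⟨he, by tauto⟩

lemma forest_bound [Fintype V] [DecidableEq V] (ends : E → V × V) (M : Finset E) (m : ℕ)
    (hMloop : ∀ e ∈ M, (ends e).1 ≠ (ends e).2) (hΔ : ∀ v, mdeg ends M v ≤ m)
    (J : Finset E) (hJ : J ⊆ M) : J.card ≤ m * grk ends J := by
  obtain ⟨k, q, hq, h2, _, h4⟩ := quot_exists ends J
  have h := mu_bound ends M m hMloop hΔ q hq univ
  have h5 := grk_add ends J
  have h6 : J.card ≤ (M.filter (fun e => q (ends e).1 = q (ends e).2 ∧
      ((ends e).1 ∈ (univ : Finset V) ∨ (ends e).2 ∈ (univ : Finset V)))).card := by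
    apply Finset.card_le_card
    intro e he
    simp [hJ he, h2 e he]
  simp only [Finset.mem_univ, not_true_eq_false, and_false, Finset.filter_false, if_true,
    Finset.sum_const, Finset.card_univ, Fintype.card_fin, smul_eq_mul, mul_one] at h h6
  rw [h4] at h5
  rw [← h5] at h
  nlinarith

lemma cross_count [Fintype V] [DecidableEq V] [Fintype E] (ends : E → V × V)
    {k : ℕ} (q : V → Fin k) (W : Finset V) :
    ∑ v ∈ W, mdeg ends univ v +
      ∑ c : Fin k, (cutEdges ends univ (univ.filter (fun v => q v = c ∧ v ∉ W))).card ≤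
    2 * (univ.filter (fun e => q (ends e).1 ≠ q (ends e).2 ∨
      (ends e).1 ∈ W ∨ (ends e).2 ∈ W)).card := by
  unfold cutEdges
  simp only [Finset.card_filter]
  rw [sum_mdeg, Finset.sum_comm, ← Finset.sum_add_distrib, Finset.mul_sum]
  apply Finset.sum_le_sum
  intro e _
  set a := (ends e).1
  set b := (ends e).2
  simp only [Finset.mem_filter, Finset.mem_univ, true_and]
  by_cases hX : q a ≠ q b ∨ a ∈ W ∨ b ∈ W
  · rw [if_pos hX]
    have h1 : ∑ c : Fin k, (if ¬ ((q a = c ∧ a ∉ W) ↔ (q b = c ∧ b ∉ W)) then 1 else 0) ≤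
        ∑ c : Fin k, ((if q a = c then (if a ∈ W then 0 else 1) else 0) +
          (if q b = c then (if b ∈ W then 0 else 1) else 0)) := by
      apply Finset.sum_le_sum
      intro c _
      split_ifs <;> first | omega | tauto
    rw [Finset.sum_add_distrib] at h1
    simp only [Finset.sum_ite_eq, Finset.mem_univ, if_true] at h1
    split_ifs at h1 ⊢ <;> omega
  · rw [if_neg hX]
    push Not at hX
    obtain ⟨h1, h2, h3⟩ := hX
    simp [h1, h2, h3]

lemma main_ineq [Fintype V] [DecidableEq V] [Fintype E] [DecidableEq E]
    (ends : E → V × V) (m : ℕ) (M M₀ : Finset E)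
    (hMloop : ∀ e ∈ M, (ends e).1 ≠ (ends e).2)
    (hΔ : ∀ v, mdeg ends M v ≤ m)
    (hM₀card : M₀.card ≤ m)
    (r : V → ℕ) (hr : ∑ v : V, r v = m - M₀.card)
    (hG : EdgeConnected ends (2 * m) (Finset.univ : Finset E))
    (z : V) (l : V → ℕ)
    (hl : ∀ v, l v + m = (mdeg ends univ v + (if v = z then 1 else 0)) / 2 + r v)
    (J : Finset E) (W : Finset V)
    (hW : ∀ e ∈ J, e ∉ M → (ends e).1 ∉ W ∧ (ends e).2 ∉ W) :
    m * Fintype.card V + ∑ v ∈ W, l v ≤ ((univ \ M₀) \ J).card + m + m * grk ends J := by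
  obtain ⟨k, q, hq, h2, _, h4⟩ := quot_exists ends J
  have h5 := grk_add ends J
  rw [h4] at h5
  rw [← h5]
  suffices m * k + ∑ v ∈ W, l v ≤ ((univ \ M₀) \ J).card + m by nlinarith
  by_cases htriv : W = ∅ ∧ k ≤ 1
  · obtain ⟨rfl, hk⟩ := htriv
    simp only [Finset.sum_empty]
    nlinarith
  have hcut : ∀ c : Fin k, 2 * m * (if (univ.filter (fun v => q v = c ∧ v ∉ W)) = ∅ then 0 else 1)
      ≤ (cutEdges ends univ (univ.filter (fun v => q v = c ∧ v ∉ W))).card := by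
    intro c
    split_ifs with hU
    · simp
    · rw [mul_one]
      apply hG _ (Finset.nonempty_iff_ne_empty.mpr hU)
      intro hun
      have hall : ∀ v, q v = c ∧ v ∉ W := by
        intro v
        have : v ∈ univ.filter (fun v => q v = c ∧ v ∉ W) := by rw [hun]; simp
        simpa using this
      apply htriv
      refine ⟨Finset.eq_empty_of_forall_notMem fun v => (hall v).2, ?_⟩
      have : ∀ d : Fin k, d = c := by
        intro d
        obtain ⟨v, hv⟩ := hq d
        rw [← hv]; exact (hall v).1
      have hs : Subsingleton (Fin k) := ⟨fun a b => (this a).trans (this b).symm⟩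
      have := Fintype.card_le_one_iff_subsingleton.mpr hs
      simpa using this
  have hcutsum := Finset.sum_le_sum (fun c (_ : c ∈ (univ : Finset (Fin k))) => hcut c)
  rw [← Finset.mul_sum] at hcutsum
  have hcount := cross_count ends q W
  have hmu := mu_bound ends M m hMloop hΔ q hq W
  have hsplit : ∑ c : Fin k, (if (univ.filter (fun v => q v = c ∧ v ∉ W)) = ∅ then 1 else 0) +
      ∑ c : Fin k, (if (univ.filter (fun v => q v = c ∧ v ∉ W)) = ∅ then 0 else 1) = k := by
    rw [← Finset.sum_add_distrib]
    calc _ = ∑ c : Fin k, 1 := by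
          apply Finset.sum_congr rfl
          intro c _
          split_ifs <;> rfl
      _ = k := by simp
  have hX : (univ.filter (fun e => q (ends e).1 ≠ q (ends e).2 ∨
      (ends e).1 ∈ W ∨ (ends e).2 ∈ W)).card ≤ ((univ \ M₀) \ J).card + M₀.card +
      (M.filter (fun e => q (ends e).1 = q (ends e).2 ∧
        ((ends e).1 ∈ W ∨ (ends e).2 ∈ W))).card := by
    refine le_trans (Finset.card_le_card (t := (((univ \ M₀) \ J) ∪ M₀) ∪
      (M.filter (fun e => q (ends e).1 = q (ends e).2 ∧
        ((ends e).1 ∈ W ∨ (ends e).2 ∈ W)))) ?_) ?_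
    · intro e
      simp only [Finset.mem_filter, Finset.mem_union, Finset.mem_sdiff, Finset.mem_univ, true_and]
      intro h
      by_cases heJ : e ∈ J
      · have := h2 e heJ
        have := hW e heJ
        tauto
      · tauto
    · refine (Finset.card_union_le _ _).trans ?_
      have := Finset.card_union_le ((univ \ M₀) \ J) M₀
      omega
  have hlW : 2 * ∑ v ∈ W, l v + 2 * (m * W.card) ≤
      ∑ v ∈ W, mdeg ends univ v + 1 + 2 * ∑ v ∈ W, r v := by
    have : ∑ v ∈ W, (2 * l v + 2 * m) ≤
        ∑ v ∈ W, (mdeg ends univ v + (if v = z then 1 else 0) + 2 * r v) := by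
      apply Finset.sum_le_sum
      intro v _
      have := hl v
      omega
    simp only [Finset.sum_add_distrib, ← Finset.mul_sum, Finset.sum_const, smul_eq_mul,
      Finset.sum_ite_eq'] at this
    have h1 : (if z ∈ W then 1 else 0) ≤ 1 := by split_ifs <;> omega
    nlinarith
  have hrW : ∑ v ∈ W, r v ≤ m - M₀.card := by
    rw [← hr]
    exact Finset.sum_le_sum_of_subset (Finset.subset_univ _)
  set α := ∑ c : Fin k, (if (univ.filter (fun v => q v = c ∧ v ∉ W)) = ∅ then 1 else 0)
  set β := ∑ c : Fin k, (if (univ.filter (fun v => q v = c ∧ v ∉ W)) = ∅ then 0 else 1)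
  have hmk : m * k = m * α + m * β := by rw [← hsplit, mul_add]
  have : 2 * m * β = 2 * (m * β) := by ring
  omega

/-- Rank function `n` on nonempty sets. -/
def capf {E : Type*} [DecidableEq E] (n : ℕ) (S : Finset E) : ℕ := if S = ∅ then 0 else n

lemma capf_mono {E : Type*} [DecidableEq E] (n : ℕ) (S T : Finset E) (h : S ⊆ T) :
    capf n S ≤ capf n T := by
  unfold capf
  by_cases h1 : S = ∅
  · simp [h1]
  · have h2 : T ≠ ∅ := by
      rintro rfl
      exact h1 (Finset.subset_empty.mp h)
    simp [h1, h2]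

lemma capf_sub {E : Type*} [DecidableEq E] (n : ℕ) (S T : Finset E) :
    capf n (S ∪ T) + capf n (S ∩ T) ≤ capf n S + capf n T := by
  unfold capf
  by_cases hS : S = ∅
  · simp [hS]
  · by_cases hT : T = ∅
    · simp [hT]
    · simp only [hS, hT, Finset.union_eq_empty, false_and, if_false]
      split_ifs <;> omega

lemma capf_empty {E : Type*} [DecidableEq E] (n : ℕ) : capf n (∅ : Finset E) = 0 := by
  simp [capf]

lemma capf_le {E : Type*} [DecidableEq E] (n : ℕ) (S : Finset E) : capf n S ≤ n := by
  unfold capf; split_ifs <;> omega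

lemma in_out_mdeg [DecidableEq V] (ends : E → V × V) (σ : E → Bool) (S : Finset E) (v : V) :
    inDeg ends σ S v + outDeg ends σ S v = mdeg ends S v := by
  unfold inDeg outDeg mdeg
  rw [Finset.card_filter, Finset.card_filter, ← Finset.sum_add_distrib]
  apply Finset.sum_congr rfl
  intro e _
  unfold ohead otail
  cases σ e
  · simp
  · simp [add_comm]

lemma sum_inDeg [Fintype V] [DecidableEq V] (ends : E → V × V) (σ : E → Bool) (S : Finset E) :
    ∑ v, inDeg ends σ S v = S.card := by
  unfold inDeg
  exact (Finset.card_eq_sum_card_fiberwise (fun _ _ => Finset.mem_coe.2 (Finset.mem_univ _))).symm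

lemma l_exists [Fintype V] [DecidableEq V] [Fintype E]
    (ends : E → V × V) (m : ℕ) (M₀ : Finset E)
    (hM₀loop : ∀ e ∈ M₀, (ends e).1 ≠ (ends e).2)
    (r : V → ℕ) (hr : ∑ v : V, r v = m - M₀.card)
    (hG : EdgeConnected ends (2 * m) (Finset.univ : Finset E)) (z : V) (v : V) :
    m ≤ (mdeg ends univ v + (if v = z then 1 else 0)) / 2 + r v := by
  by_cases h : ({v} : Finset V) = univ
  · have hs : ∀ w, w = v := by
      intro w
      have : w ∈ ({v} : Finset V) := by rw [h]; simp
      simpa using this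
    have hM : M₀ = ∅ := by
      apply Finset.eq_empty_of_forall_notMem
      intro e he
      exact hM₀loop e he ((hs _).trans (hs _).symm)
    rw [← h, hM] at hr
    simp at hr
    omega
  · have h1 := hG {v} (by simp) h
    have h2 : (cutEdges ends univ {v}).card ≤ mdeg ends univ v := by
      unfold cutEdges mdeg
      rw [Finset.card_filter]
      apply Finset.sum_le_sum
      intro e _
      simp only [Finset.mem_singleton]
      split_ifs <;> first | omega | tauto
    omega

lemma stepOne [Fintype V] [DecidableEq V] [Fintype E] [DecidableEq E]
    (ends : E → V × V) (m : ℕ) (M M₀ : Finset E)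
    (hMM₀ : Disjoint M M₀)
    (hMloop : ∀ e ∈ M, (ends e).1 ≠ (ends e).2)
    (hΔ : ∀ v, mdeg ends M v ≤ m)
    (hM₀card : M₀.card ≤ m)
    (r : V → ℕ) (hr : ∑ v : V, r v = m - M₀.card)
    (hG : EdgeConnected ends (2 * m) (Finset.univ : Finset E))
    (z : V) (l : V → ℕ)
    (hl : ∀ v, l v + m = (mdeg ends univ v + (if v = z then 1 else 0)) / 2 + r v) :
    ∃ φ : E → Fin m ⊕ Option V,
      (∀ e ∈ M, ∃ i, φ e = Sum.inl i) ∧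
      (∀ e ∉ M₀, ∀ v, φ e = Sum.inr (some v) → (ends e).1 = v ∨ (ends e).2 = v) ∧
      (∀ i J, J ⊆ univ \ M₀ → (∀ e ∈ J, φ e = Sum.inl i) → J.card ≤ grk ends J) ∧
      (∀ i, ((univ \ M₀).filter (fun e => φ e = Sum.inl i)).card + 1 = Fintype.card V) ∧
      (∀ v, ((univ \ M₀).filter (fun e => φ e = Sum.inr (some v))).card = l v) := by
  classical
  have : Nonempty V := ⟨z⟩
  have : Inhabited (Fin m ⊕ Option V) := ⟨Sum.inr none⟩
  set X : Finset E := univ \ M₀ with hX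
  have hmain := main_ineq ends m M M₀ hMloop hΔ hM₀card r hr hG z l hl
  have h0 := hmain ∅ univ (by simp)
  rw [grk_empty, Finset.sdiff_empty, ← hX] at h0
  obtain ⟨t, ht⟩ : ∃ t, m * Fintype.card V + ∑ v, l v + t = X.card + m :=
    ⟨X.card + m - (m * Fintype.card V + ∑ v, l v), by omega⟩
  let f : Fin m ⊕ Option V → Finset E → ℕ := fun i S =>
    match i with
    | Sum.inl _ => grk ends S
    | Sum.inr none => capf t S
    | Sum.inr (some v) => capf (l v) S
  let A : E → Finset (Fin m ⊕ Option V) := fun e => univ.filter (fun i =>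
    match i with
    | Sum.inl _ => True
    | Sum.inr none => e ∉ M
    | Sum.inr (some v) => e ∉ M ∧ ((ends e).1 = v ∨ (ends e).2 = v))
  have hA : ∀ J ⊆ X, J.card ≤ ∑ i, f i (J.filter (fun e => i ∈ A e)) := by
    intro J hJ
    rw [Fintype.sum_sum_type, Fintype.sum_option]
    simp only [f, A, Finset.mem_filter, Finset.mem_univ, true_and, Finset.filter_true,
      Finset.sum_const, Finset.card_univ, Fintype.card_fin, smul_eq_mul]
    by_cases hD : J.filter (fun e => e ∉ M) = ∅
    · have hJM : J ⊆ M := by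
        intro e he
        by_contra hm
        have : e ∈ J.filter (fun e => e ∉ M) := by simp [he, hm]
        rw [hD] at this; simp at this
      have := forest_bound ends M m hMloop hΔ J hJM
      omega
    · set W : Finset V := univ.filter (fun v =>
        J.filter (fun e => e ∉ M ∧ ((ends e).1 = v ∨ (ends e).2 = v)) = ∅) with hWdef
      have hW : ∀ e ∈ J, e ∉ M → (ends e).1 ∉ W ∧ (ends e).2 ∉ W := by
        intro e he hm
        constructor
        · intro hw
          simp only [hWdef, Finset.mem_filter, Finset.mem_univ, true_and] at hw
          have : e ∈ (∅ : Finset E) := by rw [← hw]; simp [he, hm]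
          simp at this
        · intro hw
          simp only [hWdef, Finset.mem_filter, Finset.mem_univ, true_and] at hw
          have : e ∈ (∅ : Finset E) := by rw [← hw]; simp [he, hm]
          simp at this
      have h1 := hmain J W hW
      rw [← hX] at h1
      have h2 : ∑ v, capf (l v) (J.filter (fun e => e ∉ M ∧ ((ends e).1 = v ∨ (ends e).2 = v)))
          + ∑ v ∈ W, l v = ∑ v, l v := by
        rw [hWdef, Finset.sum_filter, ← Finset.sum_add_distrib]
        apply Finset.sum_congr rfl
        intro v _
        unfold capf
        split_ifs <;> omega
      have h3 : capf t (J.filter (fun e => e ∉ M)) = t := by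
        unfold capf; rw [if_neg hD]
      have h4 : (X \ J).card + J.card = X.card := Finset.card_sdiff_add_card_eq_card hJ
      rw [h3]
      omega
  obtain ⟨φ, hφA, hφ⟩ := rado f
    (by
      intro i S T h
      match i with
      | Sum.inl _ => exact grk_mono ends S T h
      | Sum.inr none => exact capf_mono _ S T h
      | Sum.inr (some v) => exact capf_mono _ S T h)
    (by
      intro i S T
      match i with
      | Sum.inl _ => exact grk_sub ends S T
      | Sum.inr none => exact capf_sub _ S T
      | Sum.inr (some v) => exact capf_sub _ S T)
    (by
      intro i
      match i with
      | Sum.inl _ => exact grk_empty ends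
      | Sum.inr none => exact capf_empty _
      | Sum.inr (some v) => exact capf_empty _)
    X A hA
  have hmemX : ∀ e, e ∉ M₀ → e ∈ X := by intro e he; simp [hX, he]
  let y : Fin m ⊕ Option V → ℕ := fun i =>
    match i with
    | Sum.inl _ => Fintype.card V - 1
    | Sum.inr none => t
    | Sum.inr (some v) => l v
  have hle : ∀ i, (X.filter (fun e => φ e = i)).card ≤ y i := by
    intro i
    have h1 := hφ i (X.filter (fun e => φ e = i)) (Finset.filter_subset _ _)
      (by intro e he; exact (Finset.mem_filter.mp he).2)
    refine h1.trans ?_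
    match i with
    | Sum.inl i =>
      have := grk_lt ends (X.filter (fun e => φ e = Sum.inl i))
      simp only [f, y]; omega
    | Sum.inr none => exact capf_le _ _
    | Sum.inr (some v) => exact capf_le _ _
  have hn : 0 < Fintype.card V := Fintype.card_pos
  have hsumy : ∑ i, y i = X.card := by
    rw [Fintype.sum_sum_type, Fintype.sum_option]
    simp only [y, Finset.sum_const, Finset.card_univ, Fintype.card_fin, smul_eq_mul]
    have : m * (Fintype.card V - 1) + m = m * Fintype.card V := by
      obtain ⟨n, hn'⟩ := Nat.exists_eq_add_of_lt hn
      rw [hn']; simp [mul_add]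
    omega
  have hsumx : ∑ i, (X.filter (fun e => φ e = i)).card = X.card :=
    (Finset.card_eq_sum_card_fiberwise (fun _ _ => Finset.mem_coe.2 (Finset.mem_univ _))).symm
  have heq : ∀ i, (X.filter (fun e => φ e = i)).card = y i := by
    have := (Finset.sum_eq_sum_iff_of_le (fun i (_ : i ∈ (univ : Finset (Fin m ⊕ Option V))) =>
      hle i)).mp (hsumx.trans hsumy.symm)
    intro i
    exact this i (Finset.mem_univ i)
  refine ⟨φ, ?_, ?_, ?_, ?_, ?_⟩
  · intro e he
    have h := hφA e (hmemX e (Finset.disjoint_left.mp hMM₀ he))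
    match hc : φ e with
    | Sum.inl i => exact ⟨i, rfl⟩
    | Sum.inr none => rw [hc] at h; simp [A, he] at h
    | Sum.inr (some v) => rw [hc] at h; simp [A, he] at h
  · intro e he v hv
    have h := hφA e (hmemX e he)
    rw [hv] at h
    simp only [A, Finset.mem_filter] at h
    exact h.2.2
  · intro i J hJ h
    exact hφ (Sum.inl i) J hJ h
  · intro i
    rw [heq]
    simp only [y]; omega
  · intro v
    rw [heq]

lemma stepTwo [Fintype V] [DecidableEq V] [Fintype E] [DecidableEq E]
    (ends : E → V × V) (m : ℕ) (F : Finset E) (z : V)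
    (r : V → ℕ) (hr : ∑ v : V, r v = m)
    (hF : ∀ J ⊆ F, J.card ≤ m * grk ends J)
    (hFc : F.card + m = m * Fintype.card V) :
    ∃ ψ : E → V, (∀ e ∈ F, (ends e).1 = ψ e ∨ (ends e).2 = ψ e) ∧
      ∀ v, (F.filter (fun e => ψ e = v)).card + r v = m := by
  classical
  have : Inhabited V := ⟨z⟩
  have hrm : ∀ v, r v ≤ m := by
    intro v
    rw [← hr]
    exact Finset.single_le_sum (fun _ _ => Nat.zero_le _) (Finset.mem_univ v)
  let A : E → Finset V := fun e => {(ends e).1, (ends e).2}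
  have hA : ∀ J ⊆ F, J.card ≤ ∑ v, capf (m - r v) (J.filter (fun e => v ∈ A e)) := by
    intro J hJ
    by_cases hne : J = ∅
    · simp [hne]
    set T : Finset V := univ.filter (fun v => J.filter (fun e => v ∈ A e) ≠ ∅) with hT
    have h1 : ∑ v, capf (m - r v) (J.filter (fun e => v ∈ A e)) = ∑ v ∈ T, (m - r v) := by
      rw [hT, Finset.sum_filter]
      apply Finset.sum_congr rfl
      intro v _
      unfold capf
      by_cases h : J.filter (fun e => v ∈ A e) = ∅
      · simp only [h, if_true, ne_eq, not_true_eq_false, if_false]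
      · simp only [h, if_false, ne_eq, not_false_eq_true, if_true]
    have h2 := grk_touch ends J (Finset.nonempty_iff_ne_empty.mpr hne) T (by
      intro e he
      simp only [hT, Finset.mem_filter, Finset.mem_univ, true_and, ← Finset.nonempty_iff_ne_empty]
      exact ⟨⟨e, by simp [he, A]⟩, ⟨e, by simp [he, A]⟩⟩)
    have h3 : ∑ v ∈ T, (m - r v) + ∑ v ∈ T, r v = m * T.card := by
      rw [← Finset.sum_add_distrib]
      calc _ = ∑ v ∈ T, m := Finset.sum_congr rfl (fun v _ => Nat.sub_add_cancel (hrm v))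
        _ = _ := by simp [mul_comm]
    have h4 : ∑ v ∈ T, r v ≤ m := by
      conv_rhs => rw [← hr]
      exact Finset.sum_le_sum_of_subset (Finset.subset_univ _)
    have h5 := hF J hJ
    have h6 : m * grk ends J + m ≤ m * T.card := by
      calc _ = m * (grk ends J + 1) := by ring
        _ ≤ _ := Nat.mul_le_mul_left _ h2
    rw [h1]
    omega
  obtain ⟨ψ, hψA, hψ⟩ := rado (fun v S => capf (m - r v) S) (fun _ => capf_mono _)
    (fun _ => capf_sub _) (fun _ => capf_empty _) F A hA
  have hle : ∀ v, (F.filter (fun e => ψ e = v)).card ≤ m - r v := by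
    intro v
    exact (hψ v _ (Finset.filter_subset _ _)
      (by intro e he; exact (Finset.mem_filter.mp he).2)).trans (capf_le _ _)
  have hsum : ∑ v, (F.filter (fun e => ψ e = v)).card = F.card :=
    (Finset.card_eq_sum_card_fiberwise (fun _ _ => Finset.mem_coe.2 (Finset.mem_univ _))).symm
  have hsum2 : ∑ v, (m - r v) = F.card := by
    have : ∑ v, (m - r v) + ∑ v, r v = m * Fintype.card V := by
      rw [← Finset.sum_add_distrib]
      calc _ = ∑ v : V, m := Finset.sum_congr rfl (fun v _ => Nat.sub_add_cancel (hrm v))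
        _ = _ := by simp [mul_comm]
    omega
  have heq := (Finset.sum_eq_sum_iff_of_le (fun i (_ : i ∈ (univ : Finset V)) =>
      hle i)).mp (hsum.trans hsum2.symm)
  refine ⟨ψ, ?_, ?_⟩
  · intro e he
    have := hψA e he
    simp only [A, Finset.mem_insert, Finset.mem_singleton] at this
    tauto
  · intro v
    rw [heq v (Finset.mem_univ v)]
    exact Nat.sub_add_cancel (hrm v)

/-- Tree-connected factor together with an orientation extending a given
pre-orientation of `M₀`, with bounded out-degrees and prescribed in-degrees on `F`. -/
theorem statement_4 [Fintype V] [DecidableEq V] [Fintype E] [DecidableEq E]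
    (ends : E → V × V) (m : ℕ) (M M₀ : Finset E)
    (hMM₀ : Disjoint M M₀)
    (hMloop : ∀ e ∈ M, (ends e).1 ≠ (ends e).2)
    (hM₀loop : ∀ e ∈ M₀, (ends e).1 ≠ (ends e).2)
    (hΔ : ∀ v, mdeg ends M v ≤ m)
    (hM₀card : M₀.card ≤ m)
    (r : V → ℕ) (hr : ∑ v : V, r v = m - M₀.card)
    (σ₀ : E → Bool)
    (hG : EdgeConnected ends (2 * m) (Finset.univ : Finset E))
    (z : V) :
    ∃ F : Finset E, ∃ σ : E → Bool,
      M ⊆ F ∧ Disjoint F M₀ ∧ TreeConnected ends m F ∧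
      (∀ e ∈ M₀, σ e = σ₀ e) ∧
      (∀ v, outDeg ends σ (Finset.univ : Finset E) v
              ≤ (mdeg ends (Finset.univ : Finset E) v + 1) / 2) ∧
      (∀ v, (inDeg ends σ F v : ℤ) = (m : ℤ) - (r v : ℤ) - (inDeg ends σ₀ M₀ v : ℤ)) ∧
      outDeg ends σ (Finset.univ : Finset E) z ≤ mdeg ends (Finset.univ : Finset E) z / 2 := by
  classical
  have hlm := l_exists ends m M₀ hM₀loop r hr hG z
  obtain ⟨l, hl⟩ : ∃ l : V → ℕ, ∀ v, l v + m =
      (mdeg ends univ v + (if v = z then 1 else 0)) / 2 + r v :=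
    ⟨fun v => (mdeg ends univ v + (if v = z then 1 else 0)) / 2 + r v - m,
      fun v => Nat.sub_add_cancel (hlm v)⟩
  obtain ⟨φ, hφM, hφv, hφJ, hφi, hφl⟩ :=
    stepOne ends m M M₀ hMM₀ hMloop hΔ hM₀card r hr hG z l hl
  set F : Finset E := (univ \ M₀).filter (fun e => ∃ i, φ e = Sum.inl i) with hFdef
  have hFmem : ∀ e, e ∈ F ↔ e ∉ M₀ ∧ ∃ i, φ e = Sum.inl i := by
    intro e; simp [hFdef]
  have hdec : ∀ J ⊆ F, J.card = ∑ i : Fin m, (J.filter (fun e => φ e = Sum.inl i)).card := by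
    intro J hJ
    rw [← Finset.card_biUnion]
    · congr 1
      ext e
      simp only [Finset.mem_biUnion, Finset.mem_univ, true_and, Finset.mem_filter]
      constructor
      · intro he
        obtain ⟨i, hi⟩ := ((hFmem e).1 (hJ he)).2
        exact ⟨i, he, hi⟩
      · rintro ⟨i, he, _⟩; exact he
    · intro i _ j _ hij
      apply Finset.disjoint_left.mpr
      intro e he he'
      have h1 := (Finset.mem_filter.mp he).2
      have h2 := (Finset.mem_filter.mp he').2
      rw [h1] at h2
      exact hij (Sum.inl_injective h2)
  have hFX : F ⊆ univ \ M₀ := Finset.filter_subset _ _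
  have hFi : ∀ i, F.filter (fun e => φ e = Sum.inl i) =
      (univ \ M₀).filter (fun e => φ e = Sum.inl i) := by
    intro i
    ext e
    simp only [Finset.mem_filter, hFmem, Finset.mem_sdiff, Finset.mem_univ, true_and]
    constructor
    · tauto
    · rintro ⟨h1, h2⟩; exact ⟨⟨h1, i, h2⟩, h2⟩
  have hFJ : ∀ J ⊆ F, J.card ≤ m * grk ends J := by
    intro J hJ
    rw [hdec J hJ]
    calc _ ≤ ∑ i : Fin m, grk ends J := by
          apply Finset.sum_le_sum
          intro i _
          exact (hφJ i _ ((Finset.filter_subset _ _).trans (hJ.trans hFX))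
            (fun e he => (Finset.mem_filter.mp he).2)).trans
            (grk_mono ends _ _ (Finset.filter_subset _ _))
      _ = _ := by simp
  have hFc : F.card + m = m * Fintype.card V := by
    rw [hdec F subset_rfl]
    calc _ = ∑ i : Fin m, ((F.filter (fun e => φ e = Sum.inl i)).card + 1) := by
          rw [Finset.sum_add_distrib]; simp
      _ = ∑ i : Fin m, Fintype.card V := by
          apply Finset.sum_congr rfl
          intro i _
          rw [hFi, hφi]
      _ = _ := by simp
  have hr' : ∑ v, (r v + inDeg ends σ₀ M₀ v) = m := by
    rw [Finset.sum_add_distrib, hr, sum_inDeg]; omega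
  obtain ⟨ψ, hψe, hψc⟩ := stepTwo ends m F z _ hr' hFJ hFc
  let σ : E → Bool := fun e => if e ∈ M₀ then σ₀ e else
    if e ∈ F then decide ((ends e).2 = ψ e) else decide (φ e = Sum.inr (some (ends e).2))
  have hσ₀ : ∀ e ∈ M₀, σ e = σ₀ e := by intro e he; simp [σ, he]
  have hσF : ∀ e ∈ F, ohead ends σ e = ψ e := by
    intro e he
    have h1 := ((hFmem e).1 he).1
    have h2 := hψe e he
    simp only [ohead, σ, h1, he, if_true, if_false, decide_eq_true_eq]
    split_ifs with h
    · exact h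
    · tauto
  have hσR : ∀ e ∉ M₀, ∀ v, φ e = Sum.inr (some v) → ohead ends σ e = v := by
    intro e he v hv
    have h1 : e ∉ F := by rw [hFmem, hv]; simp
    have h2 := hφv e he v hv
    simp only [ohead, σ, he, h1, if_false, decide_eq_true_eq, hv, Sum.inr.injEq, Option.some.injEq]
    split_ifs with h
    · exact h.symm
    · rcases h2 with h2 | h2
      · exact h2
      · exact absurd h2.symm h
  have hin0 : ∀ v, inDeg ends σ M₀ v = inDeg ends σ₀ M₀ v := by
    intro v
    unfold inDeg
    congr 1
    apply Finset.filter_congr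
    intro e he
    simp [ohead, hσ₀ e he]
  have hinF : ∀ v, inDeg ends σ F v = (F.filter (fun e => ψ e = v)).card := by
    intro v
    unfold inDeg
    congr 1
    apply Finset.filter_congr
    intro e he
    rw [hσF e he]
  have hinU : ∀ v, inDeg ends σ₀ M₀ v + inDeg ends σ F v + l v ≤ inDeg ends σ univ v := by
    intro v
    rw [← hin0, ← hφl v]
    unfold inDeg
    rw [← Finset.card_union_of_disjoint, ← Finset.card_union_of_disjoint]
    · apply Finset.card_le_card
      intro e
      simp only [Finset.mem_union, Finset.mem_filter, Finset.mem_univ, true_and, Finset.mem_sdiff]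
      rintro ((h | h) | h)
      · exact h.2
      · exact h.2
      · exact hσR e h.1 v h.2
    · apply Finset.disjoint_left.mpr
      intro e
      simp only [Finset.mem_union, Finset.mem_filter, Finset.mem_univ, true_and, Finset.mem_sdiff,
        hFmem]
      rintro (⟨h, _⟩ | ⟨⟨_, i, h⟩, _⟩) ⟨h1, h2⟩
      · exact h1 h
      · rw [h] at h2; simp at h2
    · apply Finset.disjoint_left.mpr
      intro e
      simp only [Finset.mem_filter, hFmem]
      tauto
  refine ⟨F, σ, ?_, ?_, ?_, hσ₀, ?_, ?_, ?_⟩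
  · intro e he
    exact (hFmem e).2 ⟨Finset.disjoint_left.mp hMM₀ he, hφM e he⟩
  · exact Finset.disjoint_left.mpr fun e he => ((hFmem e).1 he).1
  · refine ⟨fun i => F.filter (fun e => φ e = Sum.inl i), fun i => ⟨Finset.filter_subset _ _, ?_, ?_⟩,
      ?_⟩
    · apply mconn_of_grk
      beta_reduce
      have h1 := hφJ i (F.filter (fun e => φ e = Sum.inl i)) ((Finset.filter_subset _ _).trans hFX)
        (fun e he => (Finset.mem_filter.mp he).2)
      have h2 := hφi i
      rw [← hFi] at h2
      omega
    · beta_reduce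
      rw [hFi, hφi]
    · intro i j hij
      apply Finset.disjoint_left.mpr
      intro e he he'
      have h1 := (Finset.mem_filter.mp he).2
      have h2 := (Finset.mem_filter.mp he').2
      rw [h1] at h2
      exact hij (Sum.inl_injective h2)
  · intro v
    have h1 := in_out_mdeg ends σ univ v
    have h2 := hinU v
    have h3 := hψc v
    have h4 := hl v
    rw [hinF] at h2
    split_ifs at h4 <;> omega
  · intro v
    rw [hinF]
    have h3 := hψc v
    omega
  · have h1 := in_out_mdeg ends σ univ z
    have h2 := hinU z
    have h3 := hψc z
    have h4 := hl z
    rw [hinF] at h2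
    rw [if_pos rfl] at h4
    omega
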